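/- In the Schläfli incidence structure on 27 lines, where adjacency means that the lines intersect, any two adjacent lines lie in a unique tritangent triple: for adjacent vertices u, v in the Schläfli graph, there is exactly one common neighbor w of u and v such that {u, v, w} is one of the 45 tritangent triples ({aᵢ, bⱼ, c_{ij}} for i ≠ j, or {c_{ij}, c_{kl}, c_{mn}} with {i,j,k,l,m,n} = {1,…,6}). -/

import Mathlib

/-- Vertices of the Schläfli incidence structure: the 27 lines
`a₁,…,a₆, b₁,…,b₆, c_{ij} (i < j)` on a smooth cubic surface. -/
def SchlafliVertex : Type := Fin 6 ⊕ Fin 6 ⊕ {p : Fin 6 × Fin 6 // p.1 < p.2}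

/-- Adjacency (= intersection of lines) in the Schläfli incidence structure. -/
def SchlafliAdj : SchlafliVertex → SchlafliVertex → Prop
  | .inl _, .inl _ => False
  | .inl i, .inr (.inl j) => i ≠ j
  | .inl i, .inr (.inr p) => i = p.1.1 ∨ i = p.1.2
  | .inr (.inl i), .inl j => i ≠ j
  | .inr (.inl _), .inr (.inl _) => False
  | .inr (.inl i), .inr (.inr p) => i = p.1.1 ∨ i = p.1.2
  | .inr (.inr p), .inl i => i = p.1.1 ∨ i = p.1.2
  | .inr (.inr p), .inr (.inl i) => i = p.1.1 ∨ i = p.1.2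
  | .inr (.inr p), .inr (.inr q) =>
      p.1.1 ≠ q.1.1 ∧ p.1.1 ≠ q.1.2 ∧ p.1.2 ≠ q.1.1 ∧ p.1.2 ≠ q.1.2

instance : DecidableEq SchlafliVertex := by
  unfold SchlafliVertex; infer_instance

/-- The vertex `aᵢ`. -/
def aV (i : Fin 6) : SchlafliVertex := .inl i
/-- The vertex `bᵢ`. -/
def bV (i : Fin 6) : SchlafliVertex := .inr (.inl i)
/-- The vertex `c_{ij}` (for a sorted pair `i < j`). -/
def cV (p : {p : Fin 6 × Fin 6 // p.1 < p.2}) : SchlafliVertex := .inr (.inr p)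

/-- The vertex `c_{ij}` for an arbitrary pair of distinct indices. -/
def cPair (i j : Fin 6) (h : i ≠ j) : SchlafliVertex :=
  if h' : i < j then cV ⟨(i, j), h'⟩
  else cV ⟨(j, i), lt_of_le_of_ne (not_lt.mp h') (Ne.symm h)⟩

/-- The 45 tritangent triples: `{aᵢ, bⱼ, c_{ij}}` for `i ≠ j`, and
`{c_{ij}, c_{kl}, c_{mn}}` where the pairs partition `{1,…,6}`. -/
def Tritangent (u v w : SchlafliVertex) : Prop :=
  (∃ (i j : Fin 6) (h : i ≠ j), ({u, v, w} : Finset SchlafliVertex) = {aV i, bV j, cPair i j h}) ∨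
  (∃ p q r : {p : Fin 6 × Fin 6 // p.1 < p.2},
      ({p.1.1, p.1.2, q.1.1, q.1.2, r.1.1, r.1.2} : Finset (Fin 6)) = Finset.univ ∧
      ({u, v, w} : Finset SchlafliVertex) = {cV p, cV q, cV r})

instance : Fintype SchlafliVertex :=
  inferInstanceAs (Fintype (Fin 6 ⊕ Fin 6 ⊕ {p : Fin 6 × Fin 6 // p.1 < p.2}))

instance : DecidableRel SchlafliAdj
  | .inl _, .inl _ => inferInstanceAs (Decidable False)
  | .inl i, .inr (.inl j) => inferInstanceAs (Decidable (i ≠ j))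
  | .inl i, .inr (.inr p) => inferInstanceAs (Decidable (i = p.1.1 ∨ i = p.1.2))
  | .inr (.inl i), .inl j => inferInstanceAs (Decidable (i ≠ j))
  | .inr (.inl _), .inr (.inl _) => inferInstanceAs (Decidable False)
  | .inr (.inl i), .inr (.inr p) => inferInstanceAs (Decidable (i = p.1.1 ∨ i = p.1.2))
  | .inr (.inr p), .inl i => inferInstanceAs (Decidable (i = p.1.1 ∨ i = p.1.2))
  | .inr (.inr p), .inr (.inl i) => inferInstanceAs (Decidable (i = p.1.1 ∨ i = p.1.2))
  | .inr (.inr p), .inr (.inr q) => inferInstanceAs (Decidable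
      (p.1.1 ≠ q.1.1 ∧ p.1.1 ≠ q.1.2 ∧ p.1.2 ≠ q.1.1 ∧ p.1.2 ≠ q.1.2))

theorem SchlafliAdj.symm {u v : SchlafliVertex} (h : SchlafliAdj u v) : SchlafliAdj v u := by
  rcases u with i | i | p <;> rcases v with j | j | q <;> simp only [SchlafliAdj] at h ⊢ <;> grind

/-- Adjacent vertices of the Schläfli graph have exactly one common neighbour. -/
theorem SchlafliAdj.existsUnique_common_neighbor : ∀ u v : SchlafliVertex, SchlafliAdj u v →
    ∃! w, SchlafliAdj u w ∧ SchlafliAdj v w := by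
  simp only [ExistsUnique]
  decide +kernel

theorem Tritangent.swap_left {u v w : SchlafliVertex} (h : Tritangent u v w) :
    Tritangent v u w := by
  rwa [Tritangent, Finset.insert_comm v u {w}]

theorem Tritangent.swap_right {u v w : SchlafliVertex} (h : Tritangent u v w) :
    Tritangent u w v := by
  rwa [Tritangent, Finset.pair_comm w v]

theorem tritangent_aV_bV_cV {i j : Fin 6} {p : {p : Fin 6 × Fin 6 // p.1 < p.2}}
    (hij : SchlafliAdj (aV i) (bV j)) (hip : SchlafliAdj (aV i) (cV p))
    (hjp : SchlafliAdj (bV j) (cV p)) : Tritangent (aV i) (bV j) (cV p) := by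
  obtain ⟨⟨k, l⟩, hkl⟩ := p
  have hne : i ≠ j := hij
  refine .inl ⟨i, j, hne, ?_⟩
  suffices cPair i j hne = cV ⟨(k, l), hkl⟩ by rw [this]
  simp only [aV, bV, cV, SchlafliAdj] at hip hjp
  unfold cPair
  grind

theorem tritangent_cV_cV_cV {p q r : {p : Fin 6 × Fin 6 // p.1 < p.2}}
    (hpq : SchlafliAdj (cV p) (cV q)) (hpr : SchlafliAdj (cV p) (cV r))
    (hqr : SchlafliAdj (cV q) (cV r)) : Tritangent (cV p) (cV q) (cV r) := by
  refine .inr ⟨p, q, r, Finset.eq_univ_of_card _ ?_, rfl⟩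
  have hp := p.2.ne
  have hq := q.2.ne
  have hr := r.2.ne
  simp only [cV, SchlafliAdj] at hpq hpr hqr
  simp [*]

/-- Every triangle of the Schläfli graph is tritangent. -/
theorem tritangent_of_adj {u v w : SchlafliVertex} (huv : SchlafliAdj u v)
    (huw : SchlafliAdj u w) (hvw : SchlafliAdj v w) : Tritangent u v w := by
  rcases u with i | i | p <;> rcases v with j | j | q <;> rcases w with k | k | r
  case inl.inr.inl.inr.inr => exact tritangent_aV_bV_cV huv huw hvw
  case inl.inr.inr.inr.inl => exact (tritangent_aV_bV_cV huw huv hvw.symm).swap_right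
  case inr.inl.inl.inr.inr => exact (tritangent_aV_bV_cV huv.symm hvw huw).swap_left
  case inr.inl.inr.inr.inl =>
    exact (tritangent_aV_bV_cV huw.symm hvw.symm huv).swap_left.swap_right
  case inr.inr.inl.inr.inl =>
    exact (tritangent_aV_bV_cV hvw huv.symm huw.symm).swap_right.swap_left
  case inr.inr.inr.inl.inl => exact
    (tritangent_aV_bV_cV hvw.symm huw.symm huv.symm).swap_left.swap_right.swap_left
  case inr.inr.inr.inr.inr.inr => exact tritangent_cV_cV_cV huv huw hvw
  all_goals simp only [SchlafliAdj] at huv huw hvw <;> grind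

/-- Every edge of the Schläfli graph lies in exactly one tritangent triple:
two intersecting lines on a smooth cubic surface have exactly one common
neighbor completing them to a tritangent plane. -/
theorem schlafli_unique_tritangent (u v : SchlafliVertex) (huv : SchlafliAdj u v) :
    ∃! w : SchlafliVertex, SchlafliAdj u w ∧ SchlafliAdj v w ∧ Tritangent u v w := by
  obtain ⟨w, ⟨huw, hvw⟩, huniq⟩ := SchlafliAdj.existsUnique_common_neighbor u v huv
  exact ⟨w, ⟨huw, hvw, tritangent_of_adj huv huw hvw⟩, fun w' h => huniq w' ⟨h.1, h.2.1⟩⟩
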